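/- For every integer k > 0 and every word U = U[0]U[1]⋯U[k−1] of length k over Σ = {1,2}, there are exactly two minimal C∞-words of height k whose left frontier equals U: a single-rooted word w₁ whose root is U[k−1], and a double-rooted word w₂ whose root is U[k−1]·\overline{U[k−1]}; moreover, w₁ is a prefix of w₂. -/

import Mathlib

/- Common framework: words over the alphabet Σ = {1,2} (represented as natural
numbers), run-length encoding, the derivative D, k-differentiable words C^k,
C∞-words, heights, roots, primitives, minimal/maximal words, simple extensions,
minimal forbidden words, and the left frontier Ψ. -/

namespace CinftyWords

/-- A word is a finite sequence of natural numbers. -/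
abbrev Word := List ℕ

/-- `w` is a word over the alphabet Σ = {1,2}. -/
def IsWord (w : Word) : Prop := ∀ x ∈ w, x = 1 ∨ x = 2

/-- Complement of a letter: exchanges 1 and 2. -/
def bar (x : ℕ) : ℕ := 3 - x

/-- Letterwise complement of a word. -/
def comp (w : Word) : Word := w.map bar

/-- Run-length encoding Δ: the sequence of lengths of maximal runs of equal
consecutive letters. -/
def rle (w : Word) : Word := (w.splitBy (· == ·)).map List.length

/-- Drop the first run if it has length 1. -/
def dropFirstRun1 (g : List (List ℕ)) : List (List ℕ) :=
  match g with
  | [] => []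
  | r :: rs => if r.length = 1 then rs else r :: rs

/-- The derivative `D w`: the run-length encoding of the word obtained from `w`
by deleting its first and/or last run when that run has length 1. -/
def D (w : Word) : Word :=
  ((dropFirstRun1 ((dropFirstRun1 (w.splitBy (· == ·))).reverse)).reverse).map List.length

/-- `w` is differentiable: `w` is a word over Σ and so is its run-length encoding. -/
def Diffble (w : Word) : Prop := IsWord w ∧ IsWord (rle w)

/-- The set C^k of k-differentiable words: `D^[j] w` is differentiable for all `j < k`
(so that `D^[k] w` is defined). -/
def CK (k : ℕ) : Set Word := {w | IsWord w ∧ ∀ j < k, Diffble (D^[j] w)}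

/-- The set C∞ of words differentiable arbitrarily many times. -/
def Cinf : Set Word := {w | ∀ k : ℕ, w ∈ CK k}

/-- The height of a C∞-word: the least `k` with `D^[k] w = []`. -/
noncomputable def height (w : Word) : ℕ := sInf {k | D^[k] w = []}

/-- The root of a C∞-word: `D^[height w - 1] w`. -/
noncomputable def root (w : Word) : Word := D^[height w - 1] w

/-- `v` is a primitive of `w`: `v` is differentiable and `D v = w`. -/
def IsPrimitive (v w : Word) : Prop := Diffble v ∧ D v = w

/-- A nonempty C∞-word is maximal if each `D^[j] w` (for `j ≤ height w - 2`) is a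
primitive of `D^[j+1] w` of maximal length (vacuously true when `height w = 1`). -/
def MaximalWord (w : Word) : Prop :=
  w ∈ Cinf ∧ w ≠ [] ∧ ∀ j, j + 2 ≤ height w →
    ∀ v, IsPrimitive v (D^[j + 1] w) → v.length ≤ (D^[j] w).length

/-- A nonempty C∞-word is minimal if each `D^[j] w` (for `j ≤ height w - 2`) is a
primitive of `D^[j+1] w` of minimal length (vacuously true when `height w = 1`). -/
def MinimalWord (w : Word) : Prop :=
  w ∈ Cinf ∧ w ≠ [] ∧ ∀ j, j + 2 ≤ height w →
    ∀ v, IsPrimitive v (D^[j + 1] w) → (D^[j] w).length ≤ v.length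

/-- `w` is right maximal: a suffix of a maximal word. -/
def RightMaximal (w : Word) : Prop := ∃ v, MaximalWord v ∧ w <:+ v

/-- `w` is left maximal: a prefix of a maximal word. -/
def LeftMaximal (w : Word) : Prop := ∃ v, MaximalWord v ∧ w <+: v

/-- `w` is right minimal: a suffix of a minimal word. -/
def RightMinimal (w : Word) : Prop := ∃ v, MinimalWord v ∧ w <:+ v

/-- `w` is left minimal: a prefix of a minimal word. -/
def LeftMinimal (w : Word) : Prop := ∃ v, MinimalWord v ∧ w <+: v

/-- `w` is right doubly extendable: both `w1` and `w2` are C∞-words. -/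
def RightDoublyExt (w : Word) : Prop := w ++ [1] ∈ Cinf ∧ w ++ [2] ∈ Cinf

/-- `w` is left doubly extendable: both `1w` and `2w` are C∞-words. -/
def LeftDoublyExt (w : Word) : Prop := 1 :: w ∈ Cinf ∧ 2 :: w ∈ Cinf

/-- `w` is fully extendable: `1w1`, `1w2`, `2w1`, `2w2` are all C∞-words. -/
def FullyExt (w : Word) : Prop :=
  ∀ x, (x = 1 ∨ x = 2) → ∀ y, (y = 1 ∨ y = 2) → x :: (w ++ [y]) ∈ Cinf

/-- `w'` is a right simple extension of `w`: `w' = w ++ s` is a C∞-word and at each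
step the extension by the complementary letter is not a C∞-word. -/
def RightSimpleExt (w w' : Word) : Prop :=
  w' ∈ Cinf ∧ ∃ s : Word, IsWord s ∧ w' = w ++ s ∧
    ∀ i < s.length, w ++ s.take i ++ [bar (s.getD i 0)] ∉ Cinf

/-- `w'` is a left simple extension of `w`. -/
def LeftSimpleExt (w w' : Word) : Prop := RightSimpleExt w.reverse w'.reverse

/-- `w'` is a simple extension of `w`: a right simple extension of a left simple
extension of `w`. -/
def SimpleExt (w w' : Word) : Prop := ∃ v, LeftSimpleExt w v ∧ RightSimpleExt v w'

/-- `m` is the maximal extension of `w`: a simple extension of `w` of maximal length. -/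
def IsMaximalExtension (w m : Word) : Prop :=
  SimpleExt w m ∧ ∀ v, SimpleExt w v → v.length ≤ m.length

/-- A language is factorial if it is closed under taking factors. -/
def Factorial (F : Set Word) : Prop := ∀ v ∈ F, ∀ u, u <:+: v → u ∈ F

/-- A language is anti-factorial if no word of it is a proper factor of another
word of it. -/
def AntiFactorial (M : Set Word) : Prop := ∀ u ∈ M, ∀ v ∈ M, u ≠ v → ¬ u <:+: v

/-- The set of minimal forbidden words of a (factorial) language `F`: words not
in `F` whose maximal proper prefix and maximal proper suffix are both in `F`. -/
def MF (F : Set Word) : Set Word := {v | v ∉ F ∧ v.dropLast ∈ F ∧ v.tail ∈ F}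

/-- The height of a minimal forbidden word of C∞: `k + 1`, where `k` is the
(unique) integer such that `w` is k-differentiable and `D^[k] w ∈ {111, 222}`. -/
noncomputable def MFheight (w : Word) : ℕ :=
  sInf {k | w ∈ CK k ∧ (D^[k] w = [1, 1, 1] ∨ D^[k] w = [2, 2, 2])} + 1

/-- The left frontier Ψ of a C∞-word: the word of length `height w` over {0,1,2}
recording the first letter of each derivative, with `2` replaced by `0` when the
first two letters of the previous derivative are distinct. -/
noncomputable def psi (w : Word) : List ℕ :=
  (List.range (height w)).map (fun i =>
    if i = 0 then w.getD 0 0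
    else if (D^[i] w).getD 0 0 = 2 ∧ (D^[i - 1] w).getD 0 0 ≠ (D^[i - 1] w).getD 1 0 then 0
    else (D^[i] w).getD 0 0)

end CinftyWords

namespace CinftyWords

/-- The runs of the word that starts with the letter `a` and has run lengths `r`. -/
def groups (a : ℕ) : Word → List (List ℕ)
  | [] => []
  | n :: r => List.replicate n a :: groups (bar a) r

/-- The word that starts with the letter `a` and has run lengths `r`. -/
def runs (a : ℕ) (r : Word) : Word := (groups a r).flatten

theorem runs_nil (a : ℕ) : runs a [] = [] := rfl

theorem runs_cons (a n : ℕ) (r : Word) :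
    runs a (n :: r) = List.replicate n a ++ runs (bar a) r := rfl

theorem bar_letter {a : ℕ} (ha : a = 1 ∨ a = 2) : bar a = 1 ∨ bar a = 2 := by
  rcases ha with rfl | rfl <;> simp [bar]

theorem bar_ne {a : ℕ} (ha : a = 1 ∨ a = 2) : a ≠ bar a := by
  rcases ha with rfl | rfl <;> simp [bar]

theorem eq_bar_of_ne {a b : ℕ} (ha : a = 1 ∨ a = 2) (hb : b = 1 ∨ b = 2) (h : b ≠ a) :
    b = bar a := by
  rcases ha with rfl | rfl <;> rcases hb with rfl | rfl <;> simp_all [bar]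

theorem map_length_groups (a : ℕ) (r : Word) : (groups a r).map List.length = r := by
  induction r generalizing a with
  | nil => rfl
  | cons n r ih => simp [groups, ih]

theorem length_runs (a : ℕ) (r : Word) : (runs a r).length = r.sum := by
  rw [runs, List.length_flatten, map_length_groups]

theorem isWord_runs {a : ℕ} (ha : a = 1 ∨ a = 2) (r : Word) : IsWord (runs a r) := by
  induction r generalizing a with
  | nil => simp [runs_nil, IsWord]
  | cons n r ih =>
    intro x hx
    rw [runs_cons, List.mem_append] at hx
    rcases hx with hx | hx
    · rw [List.eq_of_mem_replicate hx]; exact ha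
    · exact ih (bar_letter ha) x hx

theorem splitBy_runs {a : ℕ} (ha : a = 1 ∨ a = 2) {r : Word} (hr : ∀ n ∈ r, 0 < n) :
    (runs a r).splitBy (· == ·) = groups a r := by
  induction r generalizing a with
  | nil => rfl
  | cons n r ih =>
    have hn : n ≠ 0 := (hr n (by simp)).ne'
    have hr' : ∀ m ∈ r, 0 < m := fun m hm => hr m (by simp [hm])
    rw [runs_cons, List.splitBy_append, ih (bar_letter ha) hr', groups,
      List.splitBy_of_isChain]
    · rfl
    · simpa using hn
    · exact List.isChain_replicate_of_rel n (by simp)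
    · intro x hx y hy
      have hxa : x = a := List.eq_of_mem_replicate (List.mem_of_mem_getLast? hx)
      have hya : y = bar a := by
        cases r with
        | nil => simp [runs_nil] at hy
        | cons m r =>
          have hm : m ≠ 0 := (hr' m (by simp)).ne'
          rw [runs_cons, List.head?_append_of_ne_nil _ (by simpa using hm)] at hy
          exact List.eq_of_mem_replicate (List.mem_of_mem_head? hy)
      subst hxa hya
      simpa using bar_ne ha

theorem rle_runs {a : ℕ} (ha : a = 1 ∨ a = 2) {r : Word} (hr : ∀ n ∈ r, 0 < n) :
    rle (runs a r) = r := by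
  rw [rle, splitBy_runs ha hr, map_length_groups]

theorem exists_eq_runs (a : ℕ) (t : Word) (h : IsWord (a :: t)) :
    ∃ r, (∀ n ∈ r, 0 < n) ∧ a :: t = runs a r := by
  induction t generalizing a with
  | nil => exact ⟨[1], by simp, by simp [runs_cons, runs_nil]⟩
  | cons b t ih =>
    have ha := h a (by simp)
    have hb := h b (by simp)
    obtain ⟨r, hr, hbt⟩ := ih b (fun x hx => h x (List.mem_cons_of_mem _ hx))
    by_cases hab : b = a
    · subst hab
      cases r with
      | nil => simp [runs_nil] at hbt
      | cons n r =>
        refine ⟨(n + 1) :: r, fun m hm => ?_, ?_⟩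
        · rcases List.mem_cons.1 hm with rfl | hm
          · omega
          · exact hr m (by simp [hm])
        · rw [hbt, runs_cons, runs_cons, List.replicate_succ, List.cons_append]
    · refine ⟨1 :: r, fun m hm => ?_, ?_⟩
      · rcases List.mem_cons.1 hm with rfl | hm
        · omega
        · exact hr m hm
      · rw [hbt, runs_cons, eq_bar_of_ne ha hb hab]; rfl

theorem exists_eq_runs_rle (w : Word) (hw : IsWord w) :
    ∃ a, (a = 1 ∨ a = 2) ∧ w = runs a (rle w) := by
  cases w with
  | nil => exact ⟨1, Or.inl rfl, rfl⟩
  | cons a t =>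
    obtain ⟨r, hr, h⟩ := exists_eq_runs a t hw
    have ha := hw a (by simp)
    refine ⟨a, ha, ?_⟩
    rw [h, rle_runs ha hr]

theorem pos_of_isWord {r : Word} (hr : IsWord r) : ∀ n ∈ r, 0 < n := by
  intro n hn
  rcases hr n hn with rfl | rfl <;> decide

theorem diffble_runs {a : ℕ} (ha : a = 1 ∨ a = 2) {r : Word} (hr : IsWord r) :
    Diffble (runs a r) :=
  ⟨isWord_runs ha r, by rwa [rle_runs ha (pos_of_isWord hr)]⟩

theorem runs_prefix_runs_append (a : ℕ) (x y : Word) : runs a x <+: runs a (x ++ y) := by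
  induction x generalizing a with
  | nil => simp [runs_nil]
  | cons n x ih =>
    rw [List.cons_append, runs_cons, runs_cons]
    exact (List.prefix_append_right_inj _).2 (ih _)

theorem runs_append_one_prefix (a c : ℕ) (x y : Word) (hc : 0 < c) :
    runs a (x ++ [1]) <+: runs a (x ++ c :: y) := by
  induction x generalizing a with
  | nil =>
    obtain ⟨c, rfl⟩ : ∃ d, c = d + 1 := ⟨c - 1, by omega⟩
    simp [runs_cons, runs_nil, List.replicate_succ]
  | cons n x ih =>
    rw [List.cons_append, List.cons_append, runs_cons, runs_cons]
    exact (List.prefix_append_right_inj _).2 (ih _)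

/-- Delete the first letter if it is `1`. -/
def dropOne : Word → Word
  | [] => []
  | n :: r => if n = 1 then r else n :: r

/-- Delete the first and/or the last letter if it is `1`. -/
def trim (r : Word) : Word := (dropOne (dropOne r).reverse).reverse

theorem map_length_dropFirstRun1 (g : List (List ℕ)) :
    (dropFirstRun1 g).map List.length = dropOne (g.map List.length) := by
  cases g with
  | nil => rfl
  | cons x g => by_cases h : x.length = 1 <;> simp [dropFirstRun1, dropOne, h]

theorem D_eq_trim_rle (w : Word) : D w = trim (rle w) := by
  rw [D, trim, rle, List.map_reverse, map_length_dropFirstRun1, List.map_reverse,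
    map_length_dropFirstRun1]

theorem D_nil : D [] = [] := rfl

/-- `[1]` if the given letter is `1`, the empty word otherwise. -/
def oneIf (o : Option ℕ) : Word := if o = some 1 then [1] else []

/-- The run lengths of the shortest primitives of `u`. -/
def pad (u : Word) : Word := oneIf u.head? ++ (u ++ oneIf u.getLast?)

theorem eq_append_dropOne (r : Word) : ∃ p, r = p ++ dropOne r ∧
    (p = [1] ∨ p = [] ∧ (dropOne r).head? ≠ some 1) := by
  cases r with
  | nil => exact ⟨[], rfl, Or.inr ⟨rfl, by simp [dropOne]⟩⟩
  | cons n r =>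
    by_cases h : n = 1
    · exact ⟨[1], by simp [dropOne, h], Or.inl rfl⟩
    · exact ⟨[], by simp [dropOne, h], Or.inr ⟨rfl, by simp [dropOne, h]⟩⟩

theorem dropOne_oneIf_append {v : Word} (hv : v ≠ []) : dropOne (oneIf v.head? ++ v) = v := by
  cases v with
  | nil => exact absurd rfl hv
  | cons n v => by_cases h : n = 1 <;> simp [oneIf, dropOne, h]

theorem reverse_oneIf (o : Option ℕ) : (oneIf o).reverse = oneIf o := by
  unfold oneIf; split <;> rfl

theorem trim_pad {u : Word} (hu : u ≠ []) : trim (pad u) = u := by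
  have h1 : u.head? = (u ++ oneIf u.getLast?).head? := by
    rw [List.head?_append_of_ne_nil _ hu]
  have h2 : u.getLast? = u.reverse.head? := by simp
  rw [pad, trim, h1, dropOne_oneIf_append (by simp [hu]), List.reverse_append, reverse_oneIf,
    h2, dropOne_oneIf_append (by simp [hu]), List.reverse_reverse]

theorem sum_pad (u : Word) :
    (pad u).sum = (oneIf u.head?).sum + u.sum + (oneIf u.getLast?).sum := by
  simp [pad, add_assoc]

theorem oneIf_le_sum {p : Word} {o : Option ℕ} (hp : p = [1] ∨ p = [] ∧ o ≠ some 1) :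
    (oneIf o).sum ≤ p.sum := by
  rcases hp with rfl | ⟨rfl, ho⟩
  · unfold oneIf; split <;> simp
  · simp [oneIf, ho]

theorem eq_oneIf_of_sum_le {p : Word} {o : Option ℕ} (hp : p = [1] ∨ p = [] ∧ o ≠ some 1)
    (h : p.sum ≤ (oneIf o).sum) : p = oneIf o := by
  rcases hp with rfl | ⟨rfl, ho⟩
  · unfold oneIf at h ⊢; split <;> simp_all
  · simp [oneIf, ho]

theorem exists_eq_append_trim {r : Word} (h : trim r ≠ []) : ∃ p s, r = p ++ (trim r ++ s) ∧
    (p = [1] ∨ p = [] ∧ (trim r).head? ≠ some 1) ∧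
    (s = [1] ∨ s = [] ∧ (trim r).getLast? ≠ some 1) := by
  obtain ⟨p, hp, hp'⟩ := eq_append_dropOne r
  obtain ⟨s, hs, hs'⟩ := eq_append_dropOne (dropOne r).reverse
  have hd : dropOne r = trim r ++ s.reverse := by
    rw [trim, ← List.reverse_append, ← hs, List.reverse_reverse]
  refine ⟨p, s.reverse, ?_, ?_, ?_⟩
  · rw [← hd]; exact hp
  · rwa [hd, List.head?_append_of_ne_nil _ h] at hp'
  · have : (trim r).getLast? = (dropOne (dropOne r).reverse).head? := by simp [trim]
    rw [this]
    rcases hs' with rfl | ⟨rfl, hs'⟩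
    · exact Or.inl rfl
    · exact Or.inr ⟨rfl, hs'⟩

theorem sum_pad_trim_le {r : Word} (h : trim r ≠ []) : (pad (trim r)).sum ≤ r.sum := by
  obtain ⟨p, s, hr, hp, hs⟩ := exists_eq_append_trim h
  have := congrArg List.sum hr
  simp only [List.sum_append] at this
  rw [sum_pad, this]
  have := oneIf_le_sum hp
  have := oneIf_le_sum hs
  omega

theorem eq_pad_trim_of_sum_le {r : Word} (h : trim r ≠ []) (hle : r.sum ≤ (pad (trim r)).sum) :
    r = pad (trim r) := by
  obtain ⟨p, s, hr, hp, hs⟩ := exists_eq_append_trim h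
  have hsum := congrArg List.sum hr
  simp only [List.sum_append] at hsum
  rw [sum_pad, hsum] at hle
  have hp1 := oneIf_le_sum hp
  have hs1 := oneIf_le_sum hs
  rw [pad, ← eq_oneIf_of_sum_le hp (by omega), ← eq_oneIf_of_sum_le hs (by omega)]
  exact hr

theorem isWord_oneIf (o : Option ℕ) : IsWord (oneIf o) := by
  unfold oneIf IsWord; split <;> simp

theorem isWord_pad {u : Word} (hu : IsWord u) : IsWord (pad u) := by
  intro x hx
  simp only [pad, List.mem_append] at hx
  rcases hx with hx | hx | hx
  · exact isWord_oneIf _ x hx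
  · exact hu x hx
  · exact isWord_oneIf _ x hx

/-- The shortest primitive of `u` that starts with the letter `a`. -/
def prim (a : ℕ) (u : Word) : Word := runs a (pad u)

theorem D_prim {a : ℕ} (ha : a = 1 ∨ a = 2) {u : Word} (hu : IsWord u) (hne : u ≠ []) :
    D (prim a u) = u := by
  rw [prim, D_eq_trim_rle, rle_runs ha (pos_of_isWord (isWord_pad hu)), trim_pad hne]

theorem isPrimitive_prim {a : ℕ} (ha : a = 1 ∨ a = 2) {u : Word} (hu : IsWord u)
    (hne : u ≠ []) : IsPrimitive (prim a u) u :=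
  ⟨diffble_runs ha (isWord_pad hu), D_prim ha hu hne⟩

theorem length_prim_le {a : ℕ} {u v : Word} (hne : u ≠ []) (hv : IsPrimitive v u) :
    (prim a u).length ≤ v.length := by
  obtain ⟨⟨hw, -⟩, hD⟩ := hv
  obtain ⟨b, -, hb⟩ := exists_eq_runs_rle v hw
  rw [D_eq_trim_rle] at hD
  rw [hb, prim, length_runs, length_runs, ← hD]
  exact sum_pad_trim_le (hD ▸ hne)

theorem eq_prim_of_length_le {u v : Word} (hu : IsWord u) (hne : u ≠ []) (hv : IsPrimitive v u)
    (hmin : ∀ v', IsPrimitive v' u → v.length ≤ v'.length) :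
    ∃ a, (a = 1 ∨ a = 2) ∧ v = prim a u := by
  obtain ⟨b, hb, hvb⟩ := exists_eq_runs_rle v hv.1.1
  refine ⟨b, hb, ?_⟩
  have hle := hmin _ (isPrimitive_prim hb hu hne)
  have hD := hv.2
  rw [D_eq_trim_rle] at hD
  have hlen : v.length = (rle v).sum := by
    conv_lhs => rw [hvb]
    rw [length_runs]
  rw [hlen, prim, length_runs, ← hD] at hle
  rw [prim, ← hD, ← eq_pad_trim_of_sum_le (hD ▸ hne) hle]
  exact hvb

theorem prim_prefix_prim {a : ℕ} {u v : Word} (hne : u ≠ []) (hv : IsWord v)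
    (h : u <+: v) : prim a u <+: prim a v := by
  obtain ⟨t, rfl⟩ := h
  cases t with
  | nil => simp
  | cons c t =>
    have hc : 0 < c := pos_of_isWord hv c (by simp)
    rw [prim, prim, pad, pad, List.head?_append_of_ne_nil _ hne, List.append_assoc u,
      ← List.append_assoc, ← List.append_assoc (oneIf u.head?)]
    generalize oneIf u.head? ++ u = x
    rw [List.cons_append, oneIf]
    split
    · exact runs_append_one_prefix _ _ _ _ hc
    · rw [List.append_nil]; exact runs_prefix_runs_append _ _ _

theorem getD_zero_prim (a : ℕ) {u : Word} (hu : IsWord u) (hne : u ≠ []) :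
    (prim a u).getD 0 0 = a := by
  cases u with
  | nil => exact absurd rfl hne
  | cons n u =>
    rcases hu n (by simp) with rfl | rfl <;>
      simp [prim, pad, oneIf, runs_cons, List.replicate_succ]

theorem getD_one_prim (a : ℕ) {u : Word} (h : u.getD 0 0 = 2) :
    (prim a u).getD 1 0 = a := by
  cases u with
  | nil => simp at h
  | cons n u =>
    obtain rfl : n = 2 := by simpa using h
    simp [prim, pad, oneIf, runs_cons, List.replicate_succ]

theorem D_iterate_nil (k : ℕ) : D^[k] [] = [] := by
  induction k with
  | zero => rfl
  | succ k ih => rw [Function.iterate_succ_apply, D_nil, ih]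

theorem height_eq_succ_iff {w : Word} {k : ℕ} :
    height w = k + 1 ↔ D^[k + 1] w = [] ∧ D^[k] w ≠ [] := by
  constructor
  · intro h
    have hne : {j | D^[j] w = []}.Nonempty := by
      by_contra hne
      rw [height, Set.not_nonempty_iff_eq_empty.1 hne, Nat.sInf_empty] at h
      omega
    have hmem := Nat.sInf_mem hne
    rw [height] at h
    rw [h] at hmem
    exact ⟨hmem, Nat.notMem_of_lt_sInf (s := {j | D^[j] w = []}) (by omega)⟩
  · rintro ⟨h1, h2⟩
    refine le_antisymm (Nat.sInf_le h1) (le_csInf ⟨k + 1, h1⟩ fun j hj => ?_)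
    by_contra hlt
    obtain ⟨d, rfl⟩ : ∃ d, k = d + j := ⟨k - j, by omega⟩
    rw [Function.iterate_add_apply, show D^[j] w = [] from hj, D_iterate_nil] at h2
    exact h2 rfl

theorem height_D {w : Word} {k : ℕ} : height (D w) = k + 1 ↔ height w = k + 2 := by
  rw [height_eq_succ_iff, height_eq_succ_iff, ← Function.iterate_succ_apply,
    ← Function.iterate_succ_apply]

theorem cinf_iff {w : Word} : w ∈ Cinf ↔ ∀ j, Diffble (D^[j] w) := by
  constructor
  · exact fun h j => (h (j + 1)).2 j (Nat.lt_succ_self j)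
  · exact fun h k => ⟨(h 0).1, fun j _ => h j⟩

theorem cinf_iff_D {w : Word} : w ∈ Cinf ↔ Diffble w ∧ D w ∈ Cinf := by
  rw [cinf_iff, cinf_iff]
  constructor
  · exact fun h => ⟨h 0, fun j => h (j + 1)⟩
  · rintro ⟨h0, h⟩ (_ | j)
    · exact h0
    · exact h j

theorem isWord_of_cinf {w : Word} (hw : w ∈ Cinf) : IsWord w := (hw 0).1

theorem minimalWord_iff_D {w : Word} {k : ℕ} (hk : height w = k + 2) :
    MinimalWord w ↔ MinimalWord (D w) ∧ ∃ a, (a = 1 ∨ a = 2) ∧ w = prim a (D w) := by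
  have hk' : height (D w) = k + 1 := height_D.2 hk
  have hDne : D w ≠ [] := by
    intro h
    have := (height_eq_succ_iff.1 hk').2
    rw [h, D_iterate_nil] at this
    exact this rfl
  have hne : w ≠ [] := by
    rintro rfl
    exact hDne D_nil
  constructor
  · rintro ⟨hw, -, hmin⟩
    obtain ⟨hd, hDw⟩ := cinf_iff_D.1 hw
    refine ⟨⟨hDw, hDne, fun j hj => ?_⟩, ?_⟩
    · exact hmin (j + 1) (by omega)
    · exact eq_prim_of_length_le (isWord_of_cinf hDw) hDne ⟨hd, rfl⟩ (hmin 0 (by omega))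
  · rintro ⟨⟨hDw, -, hmin⟩, a, ha, hwa⟩
    have hp := isPrimitive_prim ha (isWord_of_cinf hDw) hDne
    rw [← hwa] at hp
    refine ⟨cinf_iff_D.2 ⟨hp.1, hDw⟩, hne, ?_⟩
    rintro (_ | j) hj
    · intro v hv
      have := length_prim_le (a := a) hDne hv
      rwa [← hwa] at this
    · exact hmin j (by omega)

theorem root_D {w : Word} {k : ℕ} (hk : height w = k + 2) : root w = root (D w) := by
  rw [root, root, hk, height_D.2 hk]
  rfl

theorem psi_eq_cons {w : Word} {k : ℕ} (hk : height w = k + 2)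
    (h : (D w).getD 0 0 = 2 → w.getD 0 0 = w.getD 1 0) :
    psi w = w.getD 0 0 :: psi (D w) := by
  rw [psi, psi, hk, height_D.2 hk, List.range_succ_eq_map, List.map_cons, List.map_map]
  congr 1
  apply List.map_congr_left
  rintro (_ | i) -
  · simp only [Function.comp_apply, Nat.succ_eq_add_one, zero_add, one_ne_zero, if_false, if_true,
      Function.iterate_one, Nat.sub_self, Function.iterate_zero, id_eq]
    rw [if_neg]
    rintro ⟨h1, h2⟩
    exact h2 (h h1)
  · simp [Function.iterate_succ_apply]

theorem psi_prim {a k : ℕ} (ha : a = 1 ∨ a = 2) {u : Word} (hu : IsWord u)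
    (hk : height u = k + 1) (hne : u ≠ []) :
    psi (prim a u) = a :: psi u := by
  have hD := D_prim ha hu hne
  rw [psi_eq_cons (k := k) (height_D.1 (by rwa [hD])), hD, getD_zero_prim a hu hne]
  rw [hD, getD_zero_prim a hu hne]
  exact fun h => (getD_one_prim a h).symm

theorem properties_prim {a k : ℕ} (ha : a = 1 ∨ a = 2) {u : Word} (hu : MinimalWord u)
    (hk : height u = k + 1) :
    MinimalWord (prim a u) ∧ height (prim a u) = k + 2 ∧ psi (prim a u) = a :: psi u ∧
      root (prim a u) = root u := by
  have hw := isWord_of_cinf hu.1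
  have hD := D_prim ha hw hu.2.1
  have hh : height (prim a u) = k + 2 := height_D.1 (by rwa [hD])
  refine ⟨(minimalWord_iff_D hh).2 ⟨by rwa [hD], a, ha, by rw [hD]⟩, hh,
    psi_prim ha hw hk hu.2.1, ?_⟩
  rw [root_D hh, hD]

theorem trim_eq_nil {r : Word} (h : trim r = []) : r = [] ∨ r = [1] ∨ r = [1, 1] := by
  obtain ⟨p, hp, hp'⟩ := eq_append_dropOne r
  obtain ⟨s, hs, hs'⟩ := eq_append_dropOne (dropOne r).reverse
  rw [trim, List.reverse_eq_nil_iff] at h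
  rw [h, List.append_nil, List.reverse_eq_iff] at hs
  rw [hs] at hp
  rcases hp' with rfl | ⟨rfl, -⟩ <;> rcases hs' with rfl | ⟨rfl, -⟩ <;> simp [hp]

theorem eq_of_height_eq_one {w : Word} (hw : IsWord w) (hh : height w = 1) :
    w = [w.getD 0 0] ∨ w = [w.getD 0 0, bar (w.getD 0 0)] := by
  obtain ⟨hD, hne⟩ := height_eq_succ_iff.1 hh
  obtain ⟨a, -, h⟩ := exists_eq_runs_rle w hw
  change D w = [] at hD
  rw [D_eq_trim_rle] at hD
  rcases trim_eq_nil hD with hr | hr | hr <;> rw [hr] at h <;> subst h <;>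
    simp_all [runs_cons, runs_nil]

theorem height_eq_one {w : Word} (hD : D w = []) (hne : w ≠ []) : height w = 1 :=
  height_eq_succ_iff.2 ⟨hD, hne⟩

theorem minimalWord_of_D_eq_nil {w : Word} (hd : Diffble w) (hD : D w = []) (hne : w ≠ []) :
    MinimalWord w := by
  refine ⟨cinf_iff_D.2 ⟨hd, ?_⟩, hne, fun j hj => ?_⟩
  · rw [hD, cinf_iff]
    intro j
    rw [D_iterate_nil]
    simp [Diffble, IsWord, rle]
  · rw [height_eq_one hD hne] at hj
    omega

theorem psi_of_height_eq_one {w : Word} (h : height w = 1) : psi w = [w.getD 0 0] := by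
  simp [psi, h]

theorem root_of_height_eq_one {w : Word} (h : height w = 1) : root w = w := by
  simp [root, h]

theorem properties_of_short {a : ℕ} (ha : a = 1 ∨ a = 2) {w : Word}
    (hw : w = [a] ∨ w = [a, bar a]) :
    MinimalWord w ∧ height w = 1 ∧ psi w = [a] ∧ root w = w := by
  obtain ⟨r, hr, hwr, ht, hne⟩ : ∃ r, IsWord r ∧ w = runs a r ∧ trim r = [] ∧ w ≠ [] := by
    rcases hw with rfl | rfl
    · exact ⟨[1], by simp [IsWord], rfl, rfl, by simp⟩
    · exact ⟨[1, 1], by simp [IsWord], rfl, rfl, by simp⟩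
  have hd : Diffble w := hwr ▸ diffble_runs ha hr
  have hD : D w = [] := by rw [hwr, D_eq_trim_rle, rle_runs ha (pos_of_isWord hr), ht]
  have hh := height_eq_one hD hne
  refine ⟨minimalWord_of_D_eq_nil hd hD hne, hh, ?_, root_of_height_eq_one hh⟩
  rw [psi_of_height_eq_one hh]
  rcases hw with rfl | rfl <;> rfl

end CinftyWords

open CinftyWords in
/-- For every `k > 0` and every word `U` of length `k` over Σ = {1,2}, there are exactly
two minimal C∞-words of height `k` with left frontier `U`: a single-rooted word `w₁`
with root `U[k-1]` and a double-rooted word `w₂` with root `U[k-1]·(U[k-1])^c`;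
moreover `w₁` is a prefix of `w₂`. -/
theorem two_minimal_words_with_given_frontier (k : ℕ) (hk : 0 < k)
    (U : Word) (hU : IsWord U) (hlen : U.length = k) :
    ∃ w₁ w₂ : Word,
      w₁ ≠ w₂ ∧
      MinimalWord w₁ ∧ height w₁ = k ∧ psi w₁ = U ∧ root w₁ = [U.getD (k - 1) 0] ∧
      MinimalWord w₂ ∧ height w₂ = k ∧ psi w₂ = U ∧
        root w₂ = [U.getD (k - 1) 0, bar (U.getD (k - 1) 0)] ∧
      w₁ <+: w₂ ∧
      ∀ w, MinimalWord w → height w = k → psi w = U → w = w₁ ∨ w = w₂ := by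
  subst hlen
  induction U with
  | nil => simp at hk
  | cons a U ih =>
    have ha := hU a (by simp)
    cases U with
    | nil =>
      obtain ⟨m1, h1, p1, r1⟩ := properties_of_short ha (Or.inl rfl)
      obtain ⟨m2, h2, p2, r2⟩ := properties_of_short ha (Or.inr rfl)
      refine ⟨[a], [a, bar a], by simp, m1, h1, p1, r1, m2, h2, p2, r2, by simp, ?_⟩
      intro w hw hh hp
      have hh : height w = 1 := hh
      rw [psi_of_height_eq_one hh, List.cons.injEq] at hp
      have := eq_of_height_eq_one (isWord_of_cinf hw.1) hh
      rwa [hp.1] at this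
    | cons b U =>
      obtain ⟨v₁, v₂, hne, m1, h1, p1, r1, m2, h2, p2, r2, hpre, huniq⟩ :=
        ih (fun x hx => hU x (List.mem_cons_of_mem _ hx)) (by simp)
      obtain ⟨m1', h1', p1', r1'⟩ := properties_prim ha m1 h1
      obtain ⟨m2', h2', p2', r2'⟩ := properties_prim ha m2 h2
      have hw1 := isWord_of_cinf m1.1
      have hw2 := isWord_of_cinf m2.1
      refine ⟨prim a v₁, prim a v₂, fun h => hne ?_, m1', h1', by rw [p1', p1],
        by rw [r1', r1]; rfl, m2', h2', by rw [p2', p2], by rw [r2', r2]; rfl,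
        prim_prefix_prim m1.2.1 hw2 hpre, ?_⟩
      · rw [← D_prim ha hw1 m1.2.1, h, D_prim ha hw2 m2.2.1]
      · intro w hw hh hp
        have hh : height w = U.length + 2 := hh
        obtain ⟨hDw, c, hc, hwc⟩ := (minimalWord_iff_D hh).1 hw
        have hDh := height_D.2 hh
        rw [hwc, psi_prim hc (isWord_of_cinf hDw.1) hDh hDw.2.1, List.cons.injEq] at hp
        obtain ⟨rfl, hp⟩ := hp
        rcases huniq _ hDw hDh hp with h | h
        · left; rwa [h] at hwc
        · right; rwa [h] at hwc
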